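/- Let E, ν, β be real numbers with E > 0 and 0 < ν < 1/2, set k = c̄₁ + 3·c̄₂, and let ε be a real 3×3 symmetric matrix with 1 + β·tr(ε) ≠ 0. Put T = 𝔼[ε]/(1+β·tr(ε)). Then k − β·tr(T) ≠ 0 and tr(ε) = tr(T)/(k − β·tr(T)); i.e. the volumetric strain (and hence the density-dependent moduli) is uniquely determined by the trace of the Cauchy stress. -/

import Mathlib

open Matrix

/-- The elasticity tensor `𝔼[M] = c̄₁·M + c̄₂·tr(M)·I` with
`c̄₁ = E/(1+ν)` and `c̄₂ = νE/((1+ν)(1−2ν))`. -/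
noncomputable def Ecal (E ν : ℝ) (M : Matrix (Fin 3) (Fin 3) ℝ) : Matrix (Fin 3) (Fin 3) ℝ :=
  (E / (1 + ν)) • M + (ν * E / ((1 + ν) * (1 - 2 * ν))) • M.trace • (1 : Matrix (Fin 3) (Fin 3) ℝ)

theorem trace_Ecal (E ν : ℝ) (M : Matrix (Fin 3) (Fin 3) ℝ) :
    (Ecal E ν M).trace =
      (E / (1 + ν) + 3 * (ν * E / ((1 + ν) * (1 - 2 * ν)))) * M.trace := by
  simp only [Ecal, trace_add, trace_smul, trace_one, Fintype.card_fin, smul_eq_mul]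
  push_cast
  ring

theorem volumetric_strain_from_stress_trace (E ν β k : ℝ) (hE : 0 < E) (hν1 : 0 < ν)
    (hν2 : ν < 1 / 2)
    (hk : k = E / (1 + ν) + 3 * (ν * E / ((1 + ν) * (1 - 2 * ν))))
    (ε : Matrix (Fin 3) (Fin 3) ℝ) (hsym : ε = εᵀ) (hden : 1 + β * ε.trace ≠ 0)
    (T : Matrix (Fin 3) (Fin 3) ℝ) (hT : T = (1 + β * ε.trace)⁻¹ • Ecal E ν ε) :
    k - β * T.trace ≠ 0 ∧ ε.trace = T.trace / (k - β * T.trace) := by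
  have hkpos : 0 < k := by
    have h : 0 < 1 - 2 * ν := by linarith
    rw [hk]
    positivity
  have htr : T.trace = k * ε.trace / (1 + β * ε.trace) := by
    rw [hT, trace_smul, trace_Ecal, ← hk, smul_eq_mul, inv_mul_eq_div]
  have hsub : k - β * T.trace = k / (1 + β * ε.trace) := by
    rw [htr]
    field_simp
    ring
  have hne : k - β * T.trace ≠ 0 := hsub ▸ div_ne_zero hkpos.ne' hden
  refine ⟨hne, ?_⟩
  rw [eq_div_iff hne, hsub, htr]
  ring
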